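/- For all integers n ≥ 2 and k ≥ 1, the image in F of the complete homogeneous symmetric polynomial h_k(L_1,…,L_n) lies in the K-subalgebra of F generated by the elements G_{n,1}, G_{n,2}, …, G_{n,k}. -/

import Mathlib

open scoped BigOperators

noncomputable section

abbrev Kq : Type := RatFunc ℚ
abbrev Pn (n : ℕ) : Type := MvPolynomial (Fin n) Kq
abbrev Fn (n : ℕ) : Type := FractionRing (Pn n)

noncomputable def qq (n : ℕ) : Fn n :=
  algebraMap (Pn n) (Fn n) (MvPolynomial.C RatFunc.X)

noncomputable def L (n : ℕ) (i : Fin n) : Fn n :=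
  algebraMap (Pn n) (Fn n) (MvPolynomial.X i)

noncomputable def P (n : ℕ) (S : Finset (Fin n)) (i : Fin n) : Fn n :=
  ∏ j ∈ S.erase i, (qq n * L n i - (qq n)⁻¹ * L n j) / (L n i - L n j)

noncomputable def G (n : ℕ) (S : Finset (Fin n)) (k : ℕ) : Fn n :=
  ∑ i ∈ S, (L n i) ^ k * P n S i

def pset (n m : ℕ) : Finset (Fin n) := Finset.univ.filter fun j => (j : ℕ) < m

/-- The complete homogeneous symmetric polynomial of degree `k` in the variables
`L_1,…,L_n`: the sum, over all multisets of size `k` with entries in `{1,…,n}`,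
of the corresponding monomials, i.e. `h_k = ∑_{1 ≤ i_1 ≤ ⋯ ≤ i_k ≤ n} L_{i_1}⋯L_{i_k}`. -/
noncomputable def hsym (n k : ℕ) : Pn n :=
  ∑ s ∈ (Finset.univ : Finset (Fin n)).sym k, (s.1.map MvPolynomial.X).prod

open Finset

/-- The generating series of the complete homogeneous symmetric polynomials evaluated at `x`. -/
noncomputable def completeSeries {ι R : Type*} [Fintype ι] [CommRing R] (x : ι → R) :
    PowerSeries R :=
  ∏ i, PowerSeries.mk fun k => x i ^ k

theorem coeff_completeSeries {ι R : Type*} [Fintype ι] [DecidableEq ι] [CommRing R] (x : ι → R)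
    (k : ℕ) :
    PowerSeries.coeff k (completeSeries x) = ∑ s : Sym ι k, (s.1.map x).prod := by
  rw [completeSeries, PowerSeries.coeff_prod]
  symm
  refine sum_bij' (fun s _ => Multiset.toFinsupp s.1)
    (fun f hf => ⟨Finsupp.toMultiset f, ?_⟩) ?_ ?_ ?_ ?_ ?_
  · rw [Finsupp.card_toMultiset]
    exact (mem_finsuppAntidiag'.1 hf).1
  · intro s _
    rw [mem_finsuppAntidiag']
    exact ⟨(Multiset.toFinsupp_sum_eq s.1).trans s.2, subset_univ _⟩
  · exact fun _ _ => mem_univ _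
  · intro s _
    exact Subtype.ext (Multiset.toFinsupp_toMultiset s.1)
  · intro f _
    exact Finsupp.toMultiset_toFinsupp f
  · intro s _
    simp only [PowerSeries.coeff_mk, Multiset.toFinsupp_apply]
    rw [prod_multiset_map_count]
    exact prod_subset (subset_univ _) fun i _ hi => by
      rw [Multiset.count_eq_zero_of_notMem (by simpa using hi), pow_zero]

theorem mk_pow_mul_one_sub {R : Type*} [CommRing R] (a : R) :
    PowerSeries.mk (fun k => a ^ k) * (1 - PowerSeries.C a * PowerSeries.X) = 1 := by
  have h := congrArg (PowerSeries.rescale a) (PowerSeries.mk_one_mul_one_sub_eq_one R)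
  rw [map_mul, map_sub, map_one, PowerSeries.rescale_X, PowerSeries.rescale_mk] at h
  simpa using h

theorem completeSeries_mul_prod {ι R : Type*} [Fintype ι] [CommRing R] (x : ι → R) :
    completeSeries x * ∏ i, (1 - PowerSeries.C (x i) * PowerSeries.X) = 1 := by
  simp [completeSeries, ← prod_mul_distrib, mk_pow_mul_one_sub]

theorem completeSeries_mul_prod_erase {ι R : Type*} [Fintype ι] [DecidableEq ι] [CommRing R]
    (x : ι → R) (i : ι) :
    completeSeries x * ∏ j ∈ univ.erase i, (1 - PowerSeries.C (x j) * PowerSeries.X) =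
      PowerSeries.mk fun k => x i ^ k := by
  rw [completeSeries, ← mul_prod_erase univ _ (mem_univ i), mul_assoc, ← prod_mul_distrib]
  simp [mk_pow_mul_one_sub]

theorem rescale_completeSeries {ι R : Type*} [Fintype ι] [CommRing R] (t : R) (x : ι → R) :
    PowerSeries.rescale t (completeSeries x) = completeSeries fun i => t * x i := by
  simp [completeSeries, map_prod, PowerSeries.rescale_mk, mul_pow]

/-- The Hall-Littlewood coefficient `∏_{j ≠ i} (x_i - t x_j) / (x_i - x_j)`. -/
noncomputable def hallCoeff {ι F : Type*} [Fintype ι] [DecidableEq ι] [Field F] (t : F)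
    (x : ι → F) (i : ι) : F :=
  ∏ j ∈ univ.erase i, (x i - t * x j) / (x i - x j)

theorem natDegree_prod_one_sub_le {ι F : Type*} [Field F] (s : Finset ι) (x : ι → F) :
    (∏ i ∈ s, (1 - Polynomial.C (x i) * Polynomial.X)).natDegree ≤ #s := by
  refine (Polynomial.natDegree_prod_le _ _).trans ?_
  refine (sum_le_card_nsmul s _ 1 fun i _ => ?_).trans (by simp)
  compute_degree

theorem prod_one_sub_eq_hallCoeff {ι F : Type*} [Fintype ι] [DecidableEq ι] [Field F] (t : F)
    (x : ι → F) (hx : Function.Injective x) (hx0 : ∀ i, x i ≠ 0) :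
    ∏ i, (1 - Polynomial.C (t * x i) * Polynomial.X) =
      ∏ i, (1 - Polynomial.C (x i) * Polynomial.X) +
        Polynomial.X * ∑ i, Polynomial.C ((1 - t) * hallCoeff t x i * x i) *
          ∏ j ∈ univ.erase i, (1 - Polynomial.C (x j) * Polynomial.X) := by
  refine Polynomial.eq_of_degrees_lt_of_eval_index_eq (univ : Finset (Option ι))
    (v := fun o => o.elim 0 fun i => (x i)⁻¹) ?_ ?_ ?_ ?_
  · rintro (_ | i) - (_ | j) - h <;> simp_all [hx.eq_iff]
  · refine Polynomial.degree_lt_iff_coeff_zero _ _ |>.2 fun m hm =>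
      Polynomial.coeff_eq_zero_of_natDegree_lt ?_
    have := natDegree_prod_one_sub_le univ fun i => t * x i
    simp at hm this ⊢
    omega
  · refine Polynomial.degree_lt_iff_coeff_zero _ _ |>.2 fun m hm =>
      Polynomial.coeff_eq_zero_of_natDegree_lt ?_
    refine lt_of_le_of_lt (Polynomial.natDegree_add_le_of_degree_le (n := Fintype.card ι)
      (natDegree_prod_one_sub_le univ x) ?_) (by simp at hm; omega)
    rw [mul_sum]
    refine Polynomial.natDegree_sum_le_of_forall_le _ _ fun i _ => ?_
    refine Polynomial.natDegree_mul_le.trans ?_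
    have h₁ := Polynomial.natDegree_C_mul_le ((1 - t) * hallCoeff t x i * x i)
      (∏ j ∈ univ.erase i, (1 - Polynomial.C (x j) * Polynomial.X))
    have h₂ := natDegree_prod_one_sub_le (univ.erase i) x
    have h₃ := card_erase_add_one (mem_univ i)
    rw [card_univ] at h₃
    rw [Polynomial.natDegree_X]
    omega
  · rintro (_ | i) -
    · simp [Polynomial.eval_prod]
    · have hvanish : ∀ s : Finset ι, i ∈ s →
          ∏ j ∈ s, (1 - x j * (x i)⁻¹) = 0 := fun s hs =>
        prod_eq_zero hs (by rw [mul_inv_cancel₀ (hx0 i), sub_self])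
      simp only [Option.elim_some, Polynomial.eval_add, Polynomial.eval_mul, Polynomial.eval_X,
        Polynomial.eval_finsetSum, Polynomial.eval_prod, Polynomial.eval_sub,
        Polynomial.eval_one, Polynomial.eval_C]
      rw [hvanish _ (mem_univ i), zero_add, sum_eq_single i
        (fun j _ hj => by rw [hvanish _ (mem_erase.2 ⟨hj.symm, mem_univ i⟩), mul_zero])
        (by simp), ← mul_prod_erase univ _ (mem_univ i), mul_assoc t,
        mul_inv_cancel₀ (hx0 i), mul_one]
      rw [show (x i)⁻¹ * ((1 - t) * hallCoeff t x i * x i *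
          ∏ j ∈ univ.erase i, (1 - x j * (x i)⁻¹)) = (1 - t) * (hallCoeff t x i *
          ∏ j ∈ univ.erase i, (1 - x j * (x i)⁻¹)) by field_simp [hx0 i],
        hallCoeff, ← prod_mul_distrib]
      congr 1
      refine prod_congr rfl fun j hj => ?_
      have hij : x i - x j ≠ 0 := sub_ne_zero.2 fun h => ne_of_mem_erase hj (hx h).symm
      have := hx0 i
      field_simp

theorem completeSeries_eq_rescale_mul {ι F : Type*} [Fintype ι] [DecidableEq ι] [Field F] (t : F)
    (x : ι → F) (hx : Function.Injective x) (hx0 : ∀ i, x i ≠ 0) :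
    completeSeries x = PowerSeries.rescale t (completeSeries x) *
      (1 + PowerSeries.X * ∑ i, PowerSeries.C ((1 - t) * hallCoeff t x i * x i) *
        PowerSeries.mk fun k => x i ^ k) := by
  have h := congrArg (Polynomial.coeToPowerSeries.ringHom (R := F))
    (prod_one_sub_eq_hallCoeff t x hx hx0)
  simp only [map_prod, map_add, map_mul, map_sum, map_sub, map_one,
    Polynomial.coeToPowerSeries.ringHom_apply, Polynomial.coe_X, Polynomial.coe_C] at h
  have hH := completeSeries_mul_prod x
  have ht := completeSeries_mul_prod fun i => t * x i
  simp only [map_mul] at ht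
  rw [rescale_completeSeries]
  simp only [← completeSeries_mul_prod_erase, mul_left_comm _ (completeSeries x), ← mul_sum,
    map_mul, map_sub, map_one] at h ⊢
  linear_combination (-completeSeries x) * ht + completeSeries x *
    (completeSeries fun i => t * x i) * h + (completeSeries fun i => t * x i) * hH

theorem one_sub_pow_mul_coeff_completeSeries {ι F : Type*} [Fintype ι] [DecidableEq ι] [Field F]
    (t : F) (x : ι → F) (hx : Function.Injective x) (hx0 : ∀ i, x i ≠ 0) (k : ℕ) :
    (1 - t ^ (k + 1)) * PowerSeries.coeff (k + 1) (completeSeries x) =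
      ∑ a ∈ antidiagonal k, t ^ a.1 * PowerSeries.coeff a.1 (completeSeries x) *
        ((1 - t) * ∑ i, x i ^ (a.2 + 1) * hallCoeff t x i) := by
  have h := congrArg (PowerSeries.coeff (k + 1)) (completeSeries_eq_rescale_mul t x hx hx0)
  rw [mul_add, mul_one, mul_left_comm, map_add, PowerSeries.coeff_succ_X_mul,
    PowerSeries.coeff_mul, PowerSeries.coeff_rescale] at h
  rw [sub_mul, one_mul, sub_eq_iff_eq_add']
  refine h.trans ?_
  congr 1
  refine sum_congr rfl fun a _ => ?_
  rw [PowerSeries.coeff_rescale, map_sum, mul_sum univ _ (1 - t)]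
  congr 1
  refine sum_congr rfl fun i _ => ?_
  rw [PowerSeries.coeff_C_mul, PowerSeries.coeff_mk]
  ring

theorem L_injective (n : ℕ) : Function.Injective (L n) :=
  (IsFractionRing.injective (Pn n) (Fn n)).comp (MvPolynomial.X_injective)

theorem L_ne_zero (n : ℕ) (i : Fin n) : L n i ≠ 0 :=
  (map_ne_zero_iff _ (IsFractionRing.injective (Pn n) (Fn n))).2 (MvPolynomial.X_ne_zero i)

theorem qq_eq_algebraMap (n : ℕ) : qq n = algebraMap Kq (Fn n) RatFunc.X := by
  rw [IsScalarTower.algebraMap_apply Kq (Pn n) (Fn n)]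
  rfl

theorem qq_ne_zero (n : ℕ) : qq n ≠ 0 := by
  rw [qq_eq_algebraMap, map_ne_zero]
  exact RatFunc.X_ne_zero

theorem P_univ_eq (n : ℕ) (i : Fin n) :
    P n univ i = qq n ^ (n - 1) * hallCoeff ((qq n)⁻¹ ^ 2) (L n) i := by
  have hcard : #(univ.erase i) = n - 1 := by simp
  rw [P, hallCoeff, ← hcard, ← prod_const, ← prod_mul_distrib]
  refine prod_congr rfl fun j _ => ?_
  have := qq_ne_zero n
  rw [← mul_div_assoc]
  congr 1
  field_simp

theorem algebraMap_hsym (n k : ℕ) :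
    algebraMap (Pn n) (Fn n) (hsym n k) = PowerSeries.coeff k (completeSeries (L n)) := by
  rw [coeff_completeSeries, hsym, sym_univ, map_sum]
  refine sum_congr rfl fun s _ => ?_
  rw [map_multiset_prod, Multiset.map_map]
  rfl

theorem ratFunc_X_pow_ne_one {k : ℕ} (hk : k ≠ 0) : (RatFunc.X : Kq) ^ k ≠ 1 := by
  rw [← RatFunc.algebraMap_X, ← map_pow, ← map_one (algebraMap (Polynomial ℚ) Kq)]
  intro h
  have := congrArg Polynomial.natDegree (RatFunc.algebraMap_injective ℚ h)
  simp at this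
  exact hk this

theorem coeff_completeSeries_L_mem (n k : ℕ) :
    PowerSeries.coeff k (completeSeries (L n)) ∈
      Algebra.adjoin Kq {x : Fn n | ∃ j ∈ Icc 1 k, x = G n univ j} := by
  induction k using Nat.strong_induction_on with
  | _ k ih =>
    rcases k with _ | k
    · have : PowerSeries.coeff 0 (completeSeries (L n)) = 1 := by
        rw [PowerSeries.coeff_zero_eq_constantCoeff_apply, completeSeries, map_prod]
        simp [← PowerSeries.coeff_zero_eq_constantCoeff_apply]
      rw [this]
      exact one_mem _
    · set A := Algebra.adjoin Kq {x : Fn n | ∃ j ∈ Icc 1 (k + 1), x = G n univ j}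
      set τ : Kq := RatFunc.X⁻¹ ^ 2 with hτ
      have ht : (qq n)⁻¹ ^ 2 = algebraMap Kq (Fn n) τ := by
        rw [qq_eq_algebraMap, hτ, map_pow, map_inv₀]
      have hτ1 : 1 - τ ^ (k + 1) ≠ 0 := by
        rw [sub_ne_zero, hτ, ← pow_mul, inv_pow]
        exact fun h => ratFunc_X_pow_ne_one (k := 2 * (k + 1)) (by omega)
          (inv_eq_one.1 h.symm)
      have hrec := one_sub_pow_mul_coeff_completeSeries ((qq n)⁻¹ ^ 2) (L n)
        (L_injective n) (L_ne_zero n) k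
      have hG (j : ℕ) : ∑ i, L n i ^ j * hallCoeff ((qq n)⁻¹ ^ 2) (L n) i =
          algebraMap Kq (Fn n) (RatFunc.X ^ (n - 1))⁻¹ * G n univ j := by
        rw [map_inv₀, map_pow, ← qq_eq_algebraMap,
          eq_inv_mul_iff_mul_eq₀ (pow_ne_zero _ (qq_ne_zero n)), G, mul_sum]
        refine sum_congr rfl fun i _ => ?_
        rw [P_univ_eq]
        ring
      have hmem : algebraMap Kq (Fn n) (1 - τ ^ (k + 1)) *
          PowerSeries.coeff (k + 1) (completeSeries (L n)) ∈ A := by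
        rw [map_sub, map_one, map_pow, ← ht, hrec]
        refine sum_mem fun a ha => ?_
        have hak := mem_antidiagonal.1 ha
        rw [hG, ht, ← map_pow, ← map_one (algebraMap Kq (Fn n)), ← map_sub]
        refine mul_mem (mul_mem (A.algebraMap_mem _) ?_)
          (mul_mem (A.algebraMap_mem _) (mul_mem (A.algebraMap_mem _) ?_))
        · refine Algebra.adjoin_mono ?_ (ih a.1 (by omega))
          rintro _ ⟨j, hj, rfl⟩
          rw [mem_Icc] at hj
          exact ⟨j, mem_Icc.2 ⟨hj.1, by omega⟩, rfl⟩
        · exact Algebra.subset_adjoin ⟨a.2 + 1, mem_Icc.2 ⟨by omega, by omega⟩, rfl⟩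
      have := mul_mem (A.algebraMap_mem (1 - τ ^ (k + 1))⁻¹) hmem
      rwa [← mul_assoc, ← map_mul, inv_mul_cancel₀ hτ1, map_one, one_mul] at this

/-- For `n ≥ 2`, `k ≥ 1`, the image of `h_k(L_1,…,L_n)` in `F` lies in the `K`-subalgebra
of `F` generated by `G_{n,1}, …, G_{n,k}`. -/
theorem stmt_9 (n k : ℕ) (hn : 2 ≤ n) (hk : 1 ≤ k) :
    algebraMap (Pn n) (Fn n) (hsym n k) ∈
      Algebra.adjoin Kq {x : Fn n | ∃ j ∈ Finset.Icc 1 k, x = G n Finset.univ j} := by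
  rw [algebraMap_hsym]
  exact coeff_completeSeries_L_mem n k
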